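/- Let H = H(2^a, 2^b; 2^c, 2^d+1) with d > 1 and max{d, a−d−1} < c < min{a, b}. Then the automorphism group of H has order 2^{b+c+2d}. -/

import Mathlib

/-- Relators for the metacyclic presentation
`⟨α, β ∣ α^n = 1, β^m = α^t, β α β⁻¹ = α^r⟩` (generator `true ↦ α`, `false ↦ β`). -/
def metacyclicRels (n m t r : ℕ) : Set (FreeGroup Bool) :=
  {FreeGroup.of true ^ n,
   FreeGroup.of false ^ m * (FreeGroup.of true ^ t)⁻¹,
   FreeGroup.of false * FreeGroup.of true * (FreeGroup.of false)⁻¹ *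
     (FreeGroup.of true ^ r)⁻¹}

/-- The metacyclic group `H(n, m; t, r)`. -/
abbrev Metacyclic (n m t r : ℕ) := PresentedGroup (metacyclicRels n m t r)

theorem two_pow_dvd_pow_sub_one {q : ℤ} {f : ℕ} (hf : 0 < f) (hq : (2 : ℤ) ^ f ∣ q - 1) (n : ℕ) :
    (2 : ℤ) ^ (f + n) ∣ q ^ 2 ^ n - 1 := by
  induction n with
  | zero => simpa using hq
  | succ n ih =>
    obtain ⟨g, rfl⟩ := Nat.exists_eq_add_of_lt hf
    obtain ⟨z, hz⟩ := ih
    have h : q ^ 2 ^ (n + 1) - 1 = (q ^ 2 ^ n - 1) * (q ^ 2 ^ n - 1 + 2) := by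
      rw [pow_succ 2 n, pow_mul]; ring
    rw [h, hz]
    exact ⟨z * (2 ^ (g + n) * z + 1), by ring⟩

/-- Sums of `2 ^ n` consecutive powers of an integer close to `1`. -/
theorem two_pow_dvd_geom_sum_sub {q : ℤ} {f : ℕ} (hq : (2 : ℤ) ^ (f + 1) ∣ q - 1) (n : ℕ) :
    (2 : ℤ) ^ (f + n) ∣ (∑ s ∈ Finset.range (2 ^ n), q ^ s) - 2 ^ n := by
  induction n with
  | zero => simp
  | succ n ih =>
    obtain ⟨z, hz⟩ := ih
    obtain ⟨y, hy⟩ := two_pow_dvd_pow_sub_one (Nat.add_one_pos f) hq n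
    have h : ∑ s ∈ Finset.range (2 ^ (n + 1)), q ^ s =
        (∑ s ∈ Finset.range (2 ^ n), q ^ s) * (q ^ 2 ^ n - 1 + 2) := by
      rw [pow_succ, mul_two, Finset.sum_range_add]
      simp only [pow_add, ← Finset.mul_sum]
      ring
    rw [h, hy, eq_add_of_sub_eq hz]
    exact ⟨2 ^ (f + n) * z * y + z + 2 ^ n * y, by ring⟩

theorem two_pow_dvd_geom_sum {q : ℤ} (hq : 2 ∣ q - 1) (n : ℕ) :
    (2 : ℤ) ^ n ∣ ∑ s ∈ Finset.range (2 ^ n), q ^ s := by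
  have h := two_pow_dvd_geom_sum_sub (f := 0) (by simpa using hq) n
  rw [zero_add] at h
  exact (dvd_sub_self_right).1 h

/-- Lifting the exponent for the base `2 ^ d + 1`. -/
theorem two_pow_dvd_base_pow_sub_one {d : ℕ} (hd : 1 < d) (n m : ℕ) :
    (2 : ℤ) ^ (d + n) ∣ (2 ^ d + 1) ^ m - 1 ↔ 2 ^ n ∣ m := by
  have h4 : (4 : ℤ) ∣ (2 ^ d + 1) - 1 := by
    rw [add_sub_cancel_right]
    exact pow_dvd_pow (2 : ℤ) hd
  have h2 : ¬ (2 : ℤ) ∣ 2 ^ d + 1 := by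
    have : (2 : ℤ) ∣ 2 ^ d := dvd_pow_self 2 (by omega)
    omega
  have h := Int.two_pow_sub_pow' m h4 h2
  rw [one_pow, add_sub_cancel_right, emultiplicity_pow_self_of_prime Int.prime_two] at h
  rw [pow_dvd_iff_le_emultiplicity, h, Nat.cast_add,
    ENat.add_le_add_iff_left (ENat.natCast_ne_top d), ← pow_dvd_iff_le_emultiplicity]
  norm_cast

/-- The map whose congruence classes control the `β`-exponent of the image of `β`. -/
def twistedPow (d : ℕ) (e : ℤ) (l : ℕ) : ℤ := (l + e) * ((2 ^ d + 1) ^ l - (2 ^ d + 1))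

theorem twistedPow_add_sub (d : ℕ) (e : ℤ) (l D : ℕ) :
    twistedPow d e (l + D) - twistedPow d e l =
      (↑(l + D) + e) * (2 ^ d + 1) ^ l * ((2 ^ d + 1) ^ D - 1)
        + D * ((2 ^ d + 1) ^ l - (2 ^ d + 1)) := by
  simp only [twistedPow]; push_cast; ring

theorem two_pow_succ_dvd_base_pow_sub_base {d : ℕ} (hd : 1 < d) {l : ℕ} (hl : Odd l) :
    (2 : ℤ) ^ (d + 1) ∣ (2 ^ d + 1) ^ l - (2 ^ d + 1) := by
  obtain ⟨m, rfl⟩ := hl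
  have h := (two_pow_dvd_base_pow_sub_one hd 1 (2 * m)).2 (by simp)
  have heq : ((2 : ℤ) ^ d + 1) ^ (2 * m + 1) - (2 ^ d + 1) =
      ((2 ^ d + 1) ^ (2 * m) - 1) * (2 ^ d + 1) := by
    rw [pow_succ]; ring
  exact heq ▸ h.mul_right (2 ^ d + 1)

theorem twistedPow_two_pow_mul {d : ℕ} (hd : 1 < d) {e : ℤ} (he : Even e) {l : ℕ} (hl : Odd l)
    {m D : ℕ} (hD : Odd D) (hm : 0 < m) :
    ∃ z : ℤ, Odd z ∧ twistedPow d e (l + 2 ^ m * D) - twistedPow d e l = 2 ^ (d + m) * z := by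
  obtain ⟨y, hy⟩ := (two_pow_dvd_base_pow_sub_one hd m (2 ^ m * D)).2 (dvd_mul_right _ _)
  obtain ⟨x, hx⟩ := two_pow_succ_dvd_base_pow_sub_base hd hl
  have hy' : Odd y := by
    rw [← Int.not_even_iff_odd]
    rintro ⟨y', rfl⟩
    have := (two_pow_dvd_base_pow_sub_one hd (m + 1) (2 ^ m * D)).1 ⟨y', by rw [hy]; ring⟩
    rw [pow_succ] at this
    have := Nat.dvd_of_mul_dvd_mul_left (by positivity) this
    exact (Nat.not_even_iff_odd.2 hD) (even_iff_two_dvd.2 this)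
  refine ⟨(↑(l + 2 ^ m * D) + e) * (2 ^ d + 1) ^ l * y + D * 2 * x, ?_, ?_⟩
  · have h1 : Odd ((2 : ℤ) ^ d + 1) := Even.add_one (by simp [Int.even_pow]; omega)
    have h2 : Odd (((l + 2 ^ m * D : ℕ) : ℤ) + e) := by
      refine Odd.add_even ?_ he
      have : Even (2 ^ m * D) := Even.mul_right (by simp [Nat.even_pow]; omega) D
      exact_mod_cast hl.add_even this
    refine Odd.add_even ((h2.mul h1.pow).mul hy') ?_
    exact ⟨D * x, by ring⟩
  · rw [twistedPow_add_sub, hy, hx]; push_cast; ring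

theorem twistedPow_congr {d : ℕ} (hd : 1 < d) {e : ℤ} {l : ℕ} (hl : Odd l) {n D : ℕ}
    (hD : 2 ^ n ∣ D) :
    (2 : ℤ) ^ (d + n) ∣ twistedPow d e (l + D) - twistedPow d e l := by
  rw [twistedPow_add_sub]
  refine dvd_add (((two_pow_dvd_base_pow_sub_one hd n D).2 hD).mul_left _) ?_
  rw [add_comm, pow_add]
  refine mul_dvd_mul (by exact_mod_cast hD) ?_
  exact (pow_dvd_pow 2 d.le_succ).trans (two_pow_succ_dvd_base_pow_sub_base hd hl)

theorem two_pow_dvd_of_twistedPow {d : ℕ} (hd : 1 < d) {e : ℤ} (he : Even e) {l D : ℕ}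
    (hl : Odd l) (hl' : Odd (l + D)) {n : ℕ}
    (h : (2 : ℤ) ^ (d + n) ∣ twistedPow d e (l + D) - twistedPow d e l) : 2 ^ n ∣ D := by
  rcases eq_or_ne D 0 with rfl | hD
  · simp
  obtain ⟨m, D', hD', rfl⟩ := Nat.exists_eq_two_pow_mul_odd hD
  have hm : 0 < m := by
    rcases Nat.eq_zero_or_pos m with rfl | hm
    · rw [pow_zero, one_mul] at hl'
      exact absurd (hl.add_odd hD') (Nat.not_even_iff_odd.2 hl')
    · exact hm
  obtain ⟨z, hz, hz'⟩ := twistedPow_two_pow_mul hd he hl hD' hm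
  refine (pow_dvd_pow 2 ?_).mul_right _
  by_contra! hlt
  rw [hz'] at h
  have := (pow_dvd_pow (2 : ℤ) (show d + m + 1 ≤ d + n by omega)).trans h
  rw [pow_succ] at this
  have := Int.dvd_of_mul_dvd_mul_left (by positivity) this
  exact (Int.not_even_iff_odd.2 hz) (even_iff_two_dvd.2 this)

theorem exists_twistedPow_congr {d : ℕ} (hd : 1 < d) {e T : ℤ} (he : Even e)
    (hT : (2 : ℤ) ^ (d + 1) ∣ T) {n : ℕ} (hn : 1 ≤ n) :
    ∃ l < 2 ^ n, Odd l ∧ (2 : ℤ) ^ (d + n) ∣ twistedPow d e l - T := by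
  induction n, hn using Nat.le_induction with
  | base => exact ⟨1, by norm_num, odd_one, by simpa [twistedPow] using hT⟩
  | succ n hn ih =>
    obtain ⟨l, hl, hodd, y, hy⟩ := ih
    rcases Int.even_or_odd y with ⟨x, rfl⟩ | hy'
    · exact ⟨l, by rw [pow_succ]; omega, hodd, x, by rw [hy]; ring⟩
    · obtain ⟨z, hz, hz'⟩ := twistedPow_two_pow_mul hd he hodd odd_one hn
      rw [mul_one] at hz'
      obtain ⟨x, hx⟩ := hy'.add_odd hz
      refine ⟨l + 2 ^ n, by rw [pow_succ]; omega, ?_, x, ?_⟩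
      · exact hodd.add_even (by simp [Nat.even_pow]; omega)
      · linear_combination hy + hz' + 2 ^ (d + n) * hx

section MetacyclicRelation

variable {G : Type*} [Group G] {A B : G} {r : ℕ}

theorem pow_mul_zpow_of_conj (h : B * A * B⁻¹ = A ^ r) (j : ℕ) (i : ℤ) :
    B ^ j * A ^ i = A ^ ((r : ℤ) ^ j * i) * B ^ j := by
  induction j generalizing i with
  | zero => simp
  | succ j ih =>
    have h1 : B * A ^ i = A ^ ((r : ℤ) * i) * B := by
      rw [← mul_inv_eq_iff_eq_mul, ← conj_zpow, h, zpow_mul, zpow_natCast]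
    rw [pow_succ, mul_assoc, h1, ← mul_assoc, ih, mul_assoc, pow_succ (r : ℤ), mul_assoc]

theorem zpow_mul_pow_mul (h : B * A * B⁻¹ = A ^ r) (i k : ℤ) (j l : ℕ) :
    A ^ i * B ^ j * (A ^ k * B ^ l) = A ^ (i + (r : ℤ) ^ j * k) * B ^ (j + l) := by
  rw [mul_assoc, ← mul_assoc (B ^ j), pow_mul_zpow_of_conj h, zpow_add, pow_add]
  simp only [mul_assoc]

theorem zpow_mul_pow_pow (h : B * A * B⁻¹ = A ^ r) (i : ℤ) (j n : ℕ) :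
    (A ^ i * B ^ j) ^ n =
      A ^ (i * ∑ s ∈ Finset.range n, ((r : ℤ) ^ j) ^ s) * B ^ (j * n) := by
  induction n with
  | zero => simp
  | succ n ih =>
    rw [pow_succ', ih, zpow_mul_pow_mul h, Finset.sum_range_succ', mul_add, add_comm j]
    simp only [pow_succ, ← Finset.sum_mul]
    congr 2
    ring

end MetacyclicRelation

namespace Metacyclic

variable {n m t r : ℕ}

/-- The generator `α`. -/
def α : Metacyclic n m t r := PresentedGroup.of true

/-- The generator `β`. -/
def β : Metacyclic n m t r := PresentedGroup.of false

theorem α_pow : (α : Metacyclic n m t r) ^ n = 1 :=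
  PresentedGroup.one_of_mem (rels := metacyclicRels n m t r) (Or.inl rfl)

theorem β_pow : (β : Metacyclic n m t r) ^ m = α ^ t :=
  mul_inv_eq_one.1
    (PresentedGroup.one_of_mem (rels := metacyclicRels n m t r) (Or.inr (Or.inl rfl)))

theorem conj_α : (β : Metacyclic n m t r) * α * β⁻¹ = α ^ r :=
  mul_inv_eq_one.1
    (PresentedGroup.one_of_mem (rels := metacyclicRels n m t r) (Or.inr (Or.inr rfl)))

section Lift

variable {G : Type*} [Group G]

/-- The homomorphism given by the universal property of the presentation. -/
def lift {x y : G} (hx : x ^ n = 1) (hy : y ^ m = x ^ t) (hxy : y * x * y⁻¹ = x ^ r) :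
    Metacyclic n m t r →* G :=
  PresentedGroup.toGroup (f := fun b => cond b x y) (by
    rintro _ (rfl | rfl | rfl)
    · simpa using hx
    · simpa [mul_inv_eq_one] using hy
    · simpa [mul_inv_eq_one] using hxy)

variable {x y : G} (hx : x ^ n = 1) (hy : y ^ m = x ^ t) (hxy : y * x * y⁻¹ = x ^ r)

@[simp] theorem lift_α : lift hx hy hxy α = x := PresentedGroup.toGroup.of _

@[simp] theorem lift_β : lift hx hy hxy β = y := PresentedGroup.toGroup.of _

theorem hom_ext {f g : Metacyclic n m t r →* G} (hα : f α = g α) (hβ : f β = g β) : f = g :=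
  PresentedGroup.ext fun b => by cases b <;> assumption

end Lift

theorem α_zpow_eq_of_dvd {i k : ℤ} (h : (n : ℤ) ∣ i - k) :
    (α : Metacyclic n m t r) ^ i = α ^ k := by
  obtain ⟨w, hw⟩ := h
  rw [eq_add_of_sub_eq hw, zpow_add, zpow_mul, zpow_natCast, α_pow, one_zpow, one_mul]

theorem β_pow_mul (k : ℕ) : (β : Metacyclic n m t r) ^ (m * k) = α ^ ((t : ℤ) * k) := by
  rw [pow_mul, β_pow, ← pow_mul, ← zpow_natCast]; push_cast; rfl

theorem exists_eq_zpow_mul_pow (hn : 0 < n) (hm : 0 < m) (g : Metacyclic n m t r) :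
    ∃ (i : ℤ) (j : ℕ), g = α ^ i * β ^ j := by
  have hg : g ∈ Subgroup.closure (Set.range PresentedGroup.of) := by
    rw [PresentedGroup.closure_range_of]; trivial
  induction hg using Subgroup.closure_induction with
  | mem x hx =>
    obtain ⟨b, rfl⟩ := hx
    cases b
    · exact ⟨0, 1, by simp [β]⟩
    · exact ⟨1, 0, by simp [α]⟩
  | one => exact ⟨0, 0, by simp⟩
  | mul x y _ _ hx hy =>
    obtain ⟨i, j, rfl⟩ := hx
    obtain ⟨k, l, rfl⟩ := hy
    exact ⟨_, _, zpow_mul_pow_mul conj_α i k j l⟩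
  | inv x _ hx =>
    obtain ⟨i, j, rfl⟩ := hx
    have hfin : (α ^ i * β ^ j : Metacyclic n m t r) ^ (m * n) = 1 := by
      rw [pow_mul, zpow_mul_pow_pow conj_α, mul_comm j, β_pow_mul, ← zpow_add, ← zpow_natCast,
        ← zpow_mul, mul_comm, zpow_mul, zpow_natCast, α_pow, one_zpow]
    have hinv : (α ^ i * β ^ j : Metacyclic n m t r)⁻¹ = (α ^ i * β ^ j) ^ (m * n - 1) := by
      rw [inv_eq_iff_mul_eq_one, ← pow_succ',
        Nat.sub_add_cancel (Nat.mul_pos hm hn), hfin]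
    exact ⟨_, _, hinv.trans (zpow_mul_pow_pow conj_α i j _)⟩

theorem exists_eq_zpow_mul_pow_lt (hn : 0 < n) (hm : 0 < m) (g : Metacyclic n m t r) :
    ∃ i < n, ∃ j < m, g = α ^ (i : ℤ) * β ^ j := by
  obtain ⟨i, j, rfl⟩ := exists_eq_zpow_mul_pow hn hm g
  have hn' : (n : ℤ) ≠ 0 := by exact_mod_cast hn.ne'
  refine ⟨((i + t * (j / m : ℕ)) % n).toNat, ?_, j % m, Nat.mod_lt _ hm, ?_⟩
  · have := Int.emod_lt_of_pos (i + t * (j / m : ℕ)) (show (0 : ℤ) < n by exact_mod_cast hn)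
    omega
  · rw [Int.toNat_of_nonneg (Int.emod_nonneg _ hn')]
    conv_lhs => rw [← Nat.div_add_mod j m, pow_add, β_pow_mul, ← mul_assoc, ← zpow_add]
    congr 1
    exact α_zpow_eq_of_dvd (Int.dvd_self_sub_emod)

theorem finite (hn : 0 < n) (hm : 0 < m) : Finite (Metacyclic n m t r) :=
  Finite.of_surjective (fun p : Fin n × Fin m => α ^ (p.1 : ℤ) * β ^ (p.2 : ℕ)) fun g => by
    obtain ⟨i, hi, j, hj, rfl⟩ := exists_eq_zpow_mul_pow_lt hn hm g
    exact ⟨(⟨i, hi⟩, ⟨j, hj⟩), rfl⟩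

section Model

/-- The action of `(ZMod n)ˣ` on `ZMod n` by multiplication, in multiplicative notation. -/
def unitAut (n : ℕ) : (ZMod n)ˣ →* MulAut (Multiplicative (ZMod n)) where
  toFun u :=
    { toFun := fun x => .ofAdd ((u : ZMod n) * x.toAdd)
      invFun := fun x => .ofAdd (((u⁻¹ : (ZMod n)ˣ) : ZMod n) * x.toAdd)
      left_inv := fun x => by simp
      right_inv := fun x => by simp
      map_mul' := fun x y => by simp [mul_add] }
  map_one' := by ext; simp
  map_mul' u v := by ext; simp [mul_assoc]

/-- The action of `ℤ` on `ZMod n` through powers of a unit. -/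
def unitAction (u : (ZMod n)ˣ) : Multiplicative ℤ →* MulAut (Multiplicative (ZMod n)) :=
  (unitAut n).comp (zpowersHom _ u)

theorem unitAction_apply (u : (ZMod n)ˣ) (j : Multiplicative ℤ) (x : Multiplicative (ZMod n)) :
    unitAction u j x = .ofAdd (((u ^ j.toAdd : (ZMod n)ˣ) : ZMod n) * x.toAdd) := rfl

/-- The semidirect product `ZMod n ⋊ ℤ` which has `H(n, m; t, r)` as a quotient. -/
abbrev Model (u : (ZMod n)ˣ) : Type := Multiplicative (ZMod n) ⋊[unitAction u] Multiplicative ℤ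

theorem inl_mem_center {u : (ZMod n)ˣ} {x : ZMod n}
    (hx : ∀ k : ℤ, ((u ^ k : (ZMod n)ˣ) : ZMod n) * x = x) :
    (SemidirectProduct.inl (.ofAdd x) : Model u) ∈ Subgroup.center (Model u) := by
  rw [Subgroup.mem_center_iff]
  intro g
  ext
  · simp [unitAction_apply, hx, mul_comm]
  · simp

theorem inr_mem_center {u : (ZMod n)ˣ} {k : ℤ} (hk : u ^ k = 1) :
    (SemidirectProduct.inr (.ofAdd k) : Model u) ∈ Subgroup.center (Model u) := by
  rw [Subgroup.mem_center_iff]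
  intro g
  ext
  · simp [unitAction_apply, hk]
  · simp [mul_comm]

theorem exists_of_zpow_mul_pow_eq_one (hr : r.Coprime n) (htr : (n : ℤ) ∣ t * (r - 1))
    (hmr : (n : ℤ) ∣ r ^ m - 1) {i : ℤ} {j : ℕ}
    (h : (α ^ i * β ^ j : Metacyclic n m t r) = 1) :
    ∃ w : ℤ, (j : ℤ) = m * w ∧ (n : ℤ) ∣ i + t * w := by
  let u : (ZMod n)ˣ := ZMod.unitOfCoprime r hr
  have hu : (u : ZMod n) = r := ZMod.coe_unitOfCoprime r hr
  let a : Model u := SemidirectProduct.inl (.ofAdd 1)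
  let b : Model u := SemidirectProduct.inr (.ofAdd 1)
  have hut (k : ℤ) : ((u ^ k : (ZMod n)ˣ) : ZMod n) * t = t := by
    have h1 : u ∈ MulAction.stabilizer (ZMod n)ˣ (t : ZMod n) := by
      rw [MulAction.mem_stabilizer_iff, Units.smul_def, hu, smul_eq_mul, ← sub_eq_zero]
      have := (ZMod.intCast_zmod_eq_zero_iff_dvd _ n).2 htr
      push_cast at this
      linear_combination this
    exact Subgroup.zpow_mem _ h1 k
  have hum : u ^ m = 1 := by
    have := (ZMod.intCast_zmod_eq_zero_iff_dvd _ n).2 hmr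
    push_cast at this
    ext
    rw [Units.val_pow_eq_pow_val, hu, Units.val_one]
    exact sub_eq_zero.1 this
  have hat : a ^ t ∈ Subgroup.center (Model u) := by
    have h1 : a ^ t = SemidirectProduct.inl (.ofAdd (t : ZMod n)) := by
      rw [← map_pow, ← ofAdd_nsmul, nsmul_one]
    exact h1 ▸ inl_mem_center hut
  have hbm : b ^ m ∈ Subgroup.center (Model u) := by
    have h1 : b ^ m = SemidirectProduct.inr (.ofAdd (m : ℤ)) := by
      rw [← map_pow, ← ofAdd_nsmul, nsmul_one]
    exact h1 ▸ inr_mem_center (by rw [zpow_natCast, hum])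
  let N : Subgroup (Model u) := Subgroup.zpowers ((a ^ t)⁻¹ * b ^ m)
  have hN : N ≤ Subgroup.center (Model u) := by
    rw [Subgroup.zpowers_le]
    exact mul_mem (inv_mem hat) hbm
  have hnorm : N.Normal := ⟨fun x hx g => by
    rwa [Subgroup.mem_center_iff.1 (hN hx) g, mul_inv_cancel_right]⟩
  have ha : a ^ n = 1 := by
    rw [← map_pow, ← ofAdd_nsmul]; simp
  have hab : b * a * b⁻¹ = a ^ r := by
    rw [← map_inv, ← SemidirectProduct.inl_aut, ← map_pow, unitAction_apply, ← ofAdd_nsmul]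
    simp [hu]
  let f : Metacyclic n m t r →* Model u ⧸ N :=
    lift (x := (a : Model u ⧸ N)) (y := (b : Model u ⧸ N)) (by rw [← QuotientGroup.mk_pow, ha]; rfl)
    (by
      rw [← QuotientGroup.mk_pow, ← QuotientGroup.mk_pow, eq_comm, QuotientGroup.eq]
      exact Subgroup.mem_zpowers _)
    (by
      rw [← QuotientGroup.mk_pow, ← hab]; rfl)
  have hf : f (α ^ i * β ^ j) = ((a ^ i * b ^ j : Model u) : Model u ⧸ N) := by
    simp [f]
  rw [h, map_one, eq_comm, QuotientGroup.eq_one_iff, Subgroup.mem_zpowers_iff] at hf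
  obtain ⟨w, hw⟩ := hf
  have hcomm : Commute (a ^ t)⁻¹ (b ^ m) := (Subgroup.mem_center_iff.1 hbm _)
  rw [hcomm.mul_zpow] at hw
  have hai (k : ℤ) : a ^ k = SemidirectProduct.inl (.ofAdd (k : ZMod n)) := by
    rw [← map_zpow, ← ofAdd_zsmul, zsmul_one]
  have hbj (k : ℤ) : b ^ k = SemidirectProduct.inr (.ofAdd k) := by
    rw [← map_zpow, ← ofAdd_zsmul, zsmul_one]; rfl
  rw [← zpow_natCast a, ← zpow_neg, ← zpow_mul, ← zpow_natCast b m, ← zpow_mul,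
    ← zpow_natCast b j, hai, hai, hbj, hbj] at hw
  refine ⟨w, ?_, ?_⟩
  · have := congrArg SemidirectProduct.right hw
    simp only [SemidirectProduct.mul_right, SemidirectProduct.right_inl,
      SemidirectProduct.right_inr, one_mul] at this
    exact (Multiplicative.ofAdd.injective this).symm
  · have := congrArg SemidirectProduct.left hw
    simp only [SemidirectProduct.mul_left, SemidirectProduct.left_inl, SemidirectProduct.left_inr,
      map_one, mul_one] at this
    rw [← ZMod.intCast_zmod_eq_zero_iff_dvd]
    have := Multiplicative.ofAdd.injective this
    push_cast at this ⊢
    linear_combination -this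

end Model

end Metacyclic

/-- Two elements that generate modulo squares, of the indicated shape, generate. -/
theorem mem_of_zpow_mul_pow_mem {G : Type*} [Group G] {A B : G} {r : ℕ}
    (h : B * A * B⁻¹ = A ^ r) (hr : (4 : ℤ) ∣ r - 1) {K : Subgroup G} {N : ℕ}
    (hA : A ^ 2 ^ N ∈ K) (hB : B ^ 2 ^ N ∈ K) {i k : ℤ} {j l : ℕ} (hi : Odd i) (hj : Even j)
    (hl : Odd l) (hx : A ^ i * B ^ j ∈ K) (hy : A ^ k * B ^ l ∈ K) : A ∈ K ∧ B ∈ K := by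
  have hS (j n : ℕ) :
      (2 : ℤ) ^ (1 + n) ∣ (∑ s ∈ Finset.range (2 ^ n), ((r : ℤ) ^ j) ^ s) - 2 ^ n :=
    two_pow_dvd_geom_sum_sub (hr.trans (sub_one_dvd_pow_sub_one _ j)) n
  induction N with
  | zero => simpa using And.intro hA hB
  | succ n ih =>
    have hA' (z : ℤ) : A ^ ((2 : ℤ) ^ (1 + n) * z) ∈ K := by
      rw [zpow_mul, add_comm]
      exact zpow_mem (by exact_mod_cast hA) z
    have hB' (z : ℕ) : B ^ (2 ^ (n + 1) * z) ∈ K := by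
      rw [pow_mul]
      exact pow_mem hB z
    have hAn : A ^ 2 ^ n ∈ K := by
      have hxn := pow_mem hx (2 ^ n)
      rw [zpow_mul_pow_pow h] at hxn
      obtain ⟨j', rfl⟩ := hj.two_dvd
      obtain ⟨i', rfl⟩ := hi
      obtain ⟨z, hz⟩ := hS (2 * j') n
      rw [K.mul_mem_cancel_right (by convert hB' j' using 2; ring), eq_add_of_sub_eq hz,
        show (2 * i' + 1) * ((2 : ℤ) ^ (1 + n) * z + 2 ^ n) =
          (2 ^ n : ℕ) + 2 ^ (1 + n) * ((2 * i' + 1) * z + i') by push_cast; ring,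
        zpow_add, K.mul_mem_cancel_right (hA' _), zpow_natCast] at hxn
      exact hxn
    refine ih hAn ?_
    have hyn := pow_mem hy (2 ^ n)
    obtain ⟨l', rfl⟩ := hl
    obtain ⟨z, hz⟩ := hS (2 * l' + 1) n
    rw [zpow_mul_pow_pow h, eq_add_of_sub_eq hz,
      show k * ((2 : ℤ) ^ (1 + n) * z + 2 ^ n) = (2 ^ n : ℕ) * (k * (2 * z + 1)) by
        push_cast; ring,
      zpow_mul, zpow_natCast, K.mul_mem_cancel_left (zpow_mem hAn _),
      show (2 * l' + 1) * 2 ^ n = 2 ^ (n + 1) * l' + 2 ^ n by ring, pow_add,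
      K.mul_mem_cancel_left (hB' _)] at hyn
    exact hyn

theorem two_pow_dvd_of_dvd_odd_mul_sub {a c : ℕ} {z R T : ℤ} (hca : c ≤ a) (hz : Odd z)
    (hT : (2 : ℤ) ^ c ∣ T) (h : (2 : ℤ) ^ a ∣ z * R - T) : (2 : ℤ) ^ c ∣ R := by
  have h1 : (2 : ℤ) ^ c ∣ z * R := (dvd_sub_left hT).1 ((pow_dvd_pow 2 hca).trans h)
  refine IsCoprime.dvd_of_dvd_mul_left ?_ h1
  exact (Int.isCoprime_two_left.2 hz).pow_left

namespace TypeI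

open Metacyclic

variable (p q v w : ℕ)

/-- The group `H(2^a, 2^b; 2^c, 2^d + 1)`, where `p = c - d`, `q = a - c`, `v = b - c` and
`w = c + d - a`. -/
abbrev H := Metacyclic (2 ^ (p + 2 * q + w)) (2 ^ (p + q + v + w)) (2 ^ (p + q + w))
  (2 ^ (q + w) + 1)

/-- The difference, modulo `2 ^ (a - c)`, of the `α`-exponent of the image of `α` and the
`β`-exponent of the image of `β`. -/
def offset (J : ℕ) (k : ℤ) : ℤ := 2 ^ v * k - 2 ^ p * J

/-- The value prescribed for `twistedPow` by the conjugation relation. -/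
def target (J : ℕ) (k : ℤ) : ℤ :=
  k * ((2 ^ (q + w) + 1) ^ (2 ^ (p + v) * J) - 1) + 2 ^ (p + q + w) * J

variable {p q v w}

theorem exists_of_eq_one (hd : 1 < q + w) {i : ℤ} {j : ℕ} (h : (α ^ i * β ^ j : H p q v w) = 1) :
    ∃ x : ℤ, (j : ℤ) = 2 ^ (p + q + v + w) * x ∧
      (2 : ℤ) ^ (p + 2 * q + w) ∣ i + 2 ^ (p + q + w) * x := by
  have hr : (2 ^ (q + w) + 1).Coprime (2 ^ (p + 2 * q + w)) := by
    refine Nat.Coprime.pow_right _ (Nat.coprime_two_right.2 (Even.add_one ?_))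
    simp [Nat.even_pow]; omega
  have htr : ((2 ^ (p + 2 * q + w) : ℕ) : ℤ) ∣
      (2 ^ (p + q + w) : ℕ) * ((2 ^ (q + w) + 1 : ℕ) - 1) := by
    push_cast
    exact ⟨2 ^ w, by ring⟩
  have hmr : ((2 ^ (p + 2 * q + w) : ℕ) : ℤ) ∣
      ((2 ^ (q + w) + 1 : ℕ) : ℤ) ^ 2 ^ (p + q + v + w) - 1 := by
    push_cast
    exact (pow_dvd_pow 2 (by omega)).trans
      ((two_pow_dvd_base_pow_sub_one hd (p + q + v + w) _).2 dvd_rfl)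
  exact_mod_cast exists_of_zpow_mul_pow_eq_one hr htr hmr h

theorem α_zpow_eq_iff (hd : 1 < q + w) {i k : ℤ} :
    (α : H p q v w) ^ i = α ^ k ↔ (2 : ℤ) ^ (p + 2 * q + w) ∣ i - k := by
  refine ⟨fun h => ?_, fun h => α_zpow_eq_of_dvd (by exact_mod_cast h)⟩
  obtain ⟨x, hx, hd⟩ := exists_of_eq_one (p := p) (v := v) hd (i := i - k) (j := 0)
    (by rw [zpow_sub, h]; simp)
  have : x = 0 := by simpa using hx.symm
  simpa [this] using hd

theorem eq_of_zpow_mul_pow_eq (hd : 1 < q + w) {i k : ℤ} {j l : ℕ}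
    (hj : j < 2 ^ (p + q + v + w))
    (hl : l < 2 ^ (p + q + v + w)) (h : (α ^ i * β ^ j : H p q v w) = α ^ k * β ^ l) :
    j = l ∧ (2 : ℤ) ^ (p + 2 * q + w) ∣ i - k := by
  have hjl : j = l := by
    wlog hle : j ≤ l generalizing i j k l
    · exact (this hl hj h.symm (by omega)).symm
    obtain ⟨s, rfl⟩ := Nat.exists_eq_add_of_le' hle
    obtain ⟨x, hx, -⟩ := exists_of_eq_one (p := p) (v := v) hd (i := k - i)
      (j := s) (by
        rw [pow_add β s j, ← mul_assoc] at h
        rw [zpow_sub, ← zpow_neg, (Commute.refl α).zpow_zpow, mul_assoc, ← mul_right_cancel h,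
          ← zpow_add, neg_add_cancel, zpow_zero])
    have : s = 0 := by
      refine Nat.eq_zero_of_dvd_of_lt ?_ (show s < 2 ^ (p + q + v + w) by omega)
      exact_mod_cast (Dvd.intro x hx.symm : (2 : ℤ) ^ (p + q + v + w) ∣ s)
    omega
  subst hjl
  exact ⟨rfl, (α_zpow_eq_iff hd).1 (mul_right_cancel h)⟩

theorem two_pow_dvd_geom_sum_base {d : ℕ} (hd : 1 < d) {j f n e : ℕ} (hj : 2 ^ f ∣ j)
    (he : e < d + f + n) :
    (2 : ℤ) ^ e ∣ ∑ s ∈ Finset.range (2 ^ n), ((2 ^ d + 1 : ℤ) ^ j) ^ s - 2 ^ n := by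
  obtain ⟨g, hg⟩ : ∃ g, d + f = g + 1 := ⟨d + f - 1, by omega⟩
  have h := two_pow_dvd_geom_sum_sub (hg ▸ (two_pow_dvd_base_pow_sub_one hd f j).2 hj) n
  exact (pow_dvd_pow 2 (by omega)).trans h

theorem cast_base (d : ℕ) : ((2 ^ d + 1 : ℕ) : ℤ) = 2 ^ d + 1 := by push_cast; rfl

theorem β_pow_two_pow_mul (k : ℕ) :
    (β : H p q v w) ^ (2 ^ (p + q + v + w) * k) = α ^ ((2 : ℤ) ^ (p + q + w) * k) := by
  rw [β_pow_mul]; push_cast; rfl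

theorem pow_eq_one (hd : 1 < q + w) (i : ℤ) (J : ℕ) :
    (α ^ i * β ^ (2 ^ (p + v) * J) : H p q v w) ^ 2 ^ (p + 2 * q + w) = 1 := by
  obtain ⟨z, hz⟩ := two_pow_dvd_geom_sum (q := (2 ^ (q + w) + 1) ^ (2 ^ (p + v) * J))
    ((dvd_pow_self 2 (by omega)).trans
      ((two_pow_dvd_base_pow_sub_one hd 0 _).2 (by simp))) (p + 2 * q + w)
  rw [zpow_mul_pow_pow conj_α, cast_base, hz,
    show 2 ^ (p + v) * J * 2 ^ (p + 2 * q + w) =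
      2 ^ (p + q + v + w) * (2 ^ (p + q) * J) by ring,
    β_pow_two_pow_mul, ← zpow_add, ← zpow_zero α, α_zpow_eq_iff hd, sub_zero]
  refine dvd_add ⟨i * z, by ring⟩ ?_
  push_cast
  rw [← mul_assoc, ← pow_add]
  exact (pow_dvd_pow 2 (by omega)).mul_right _

theorem pow_eq_pow_iff (hd : 1 < q + w) (hv : 0 < v) {i k : ℤ} {J l : ℕ} :
    (α ^ k * β ^ l : H p q v w) ^ 2 ^ (p + q + v + w) =
        (α ^ i * β ^ (2 ^ (p + v) * J)) ^ 2 ^ (p + q + w) ↔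
      (2 : ℤ) ^ q ∣ l + offset p v J k - i := by
  obtain ⟨x, hx⟩ := two_pow_dvd_geom_sum_base hd (j := l) (f := 0) (n := p + q + v + w)
    (e := p + 2 * q + w) (by simp) (by omega)
  obtain ⟨y, hy⟩ := two_pow_dvd_geom_sum_base hd (f := p + v) (n := p + q + w)
    (e := p + 2 * q + w) (Nat.dvd_mul_right (2 ^ (p + v)) J) (by omega)
  rw [zpow_mul_pow_pow conj_α, zpow_mul_pow_pow conj_α, cast_base, mul_comm l,
    show 2 ^ (p + v) * J * 2 ^ (p + q + w) = 2 ^ (p + q + v + w) * (2 ^ p * J) by ring,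
    β_pow_two_pow_mul, β_pow_two_pow_mul, ← zpow_add, ← zpow_add, α_zpow_eq_iff hd,
    eq_add_of_sub_eq hx, eq_add_of_sub_eq hy]
  have h : k * (2 ^ (p + 2 * q + w) * x + 2 ^ (p + q + v + w)) + 2 ^ (p + q + w) * (l : ℤ) -
      (i * (2 ^ (p + 2 * q + w) * y + 2 ^ (p + q + w)) +
        2 ^ (p + q + w) * ((2 ^ p * J : ℕ) : ℤ)) =
      2 ^ (p + 2 * q + w) * (k * x - i * y) + 2 ^ (p + q + w) * (l + offset p v J k - i) := by
    simp only [offset]; push_cast; ring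
  rw [h, dvd_add_right (dvd_mul_right _ _), show p + 2 * q + w = (p + q + w) + q by ring, pow_add]
  exact mul_dvd_mul_iff_left (by positivity)

theorem conj_eq_pow_iff (hd : 1 < q + w) (hv : 0 < v) {i k : ℤ} {J l : ℕ} :
    (α ^ k * β ^ l : H p q v w) * (α ^ i * β ^ (2 ^ (p + v) * J)) * (α ^ k * β ^ l)⁻¹ =
        (α ^ i * β ^ (2 ^ (p + v) * J)) ^ (2 ^ (q + w) + 1) ↔
      (2 : ℤ) ^ (p + 2 * q + w) ∣
        i * ((2 ^ (q + w) + 1) ^ l - (2 ^ (q + w) + 1)) - target p q v w J k := by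
  obtain ⟨x, hx⟩ := two_pow_dvd_geom_sum_base hd (f := p + v) (n := q + w)
    (e := p + 2 * q + w) (Nat.dvd_mul_right (2 ^ (p + v)) J) (by omega)
  obtain ⟨y, hy⟩ := (pow_dvd_pow 2 (show p + 2 * q + w ≤ q + w + (p + v + (q + w)) by omega)).trans
    ((two_pow_dvd_base_pow_sub_one hd (p + v + (q + w)) (2 ^ (p + v) * J * 2 ^ (q + w))).2
      ⟨J, by ring⟩)
  rw [mul_inv_eq_iff_eq_mul, zpow_mul_pow_pow conj_α, zpow_mul_pow_mul conj_α,
    zpow_mul_pow_mul conj_α,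
    show 2 ^ (p + v) * J * (2 ^ (q + w) + 1) + l =
      2 ^ (p + q + v + w) * J + (l + 2 ^ (p + v) * J) by ring,
    pow_add β (2 ^ (p + q + v + w) * J), β_pow_two_pow_mul, ← mul_assoc, ← zpow_add, mul_left_inj,
    α_zpow_eq_iff hd, cast_base, Finset.sum_range_succ, eq_add_of_sub_eq hx, ← pow_mul,
    mul_add_one (2 ^ (p + v) * J), pow_add _ (2 ^ (p + v) * J * 2 ^ (q + w)),
    eq_add_of_sub_eq hy]
  have h : k + (2 ^ (q + w) + 1) ^ l * i -
      (i * (2 ^ (p + 2 * q + w) * x + 2 ^ (q + w) + (2 ^ (p + 2 * q + w) * y + 1)) +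
        (2 ^ (p + 2 * q + w) * y + 1) * (2 ^ (q + w) + 1) ^ (2 ^ (p + v) * J) * k +
        2 ^ (p + q + w) * J) =
      2 ^ (p + 2 * q + w) *
        (-(i * x) - i * y - y * (2 ^ (q + w) + 1) ^ (2 ^ (p + v) * J) * k) +
      (i * ((2 ^ (q + w) + 1) ^ l - (2 ^ (q + w) + 1)) - target p q v w J k) := by
    simp only [target]; ring
  rw [h, dvd_add_right (dvd_mul_right _ _)]

theorem exists_eq_of_conj_eq_pow (hd : 1 < q + w) {i k : ℤ} {j l : ℕ}
    (h : (α ^ k * β ^ l : H p q v w) * (α ^ i * β ^ j) * (α ^ k * β ^ l)⁻¹ =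
        (α ^ i * β ^ j) ^ (2 ^ (q + w) + 1)) :
    ∃ J, j = 2 ^ (p + v) * J := by
  rw [mul_inv_eq_iff_eq_mul, zpow_mul_pow_pow conj_α, zpow_mul_pow_mul conj_α,
    zpow_mul_pow_mul conj_α,
    show j * (2 ^ (q + w) + 1) + l = j * 2 ^ (q + w) + (l + j) by ring,
    pow_add β (j * 2 ^ (q + w)), ← mul_assoc, mul_left_inj, ← inv_mul_eq_one, ← mul_assoc,
    ← zpow_neg, ← zpow_add] at h
  obtain ⟨x, hx, -⟩ := exists_of_eq_one hd h
  have h1 : 2 ^ (p + q + v + w) ∣ j * 2 ^ (q + w) := by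
    exact_mod_cast Dvd.intro x hx.symm
  rw [show p + q + v + w = p + v + (q + w) by ring, pow_add] at h1
  exact Nat.dvd_of_mul_dvd_mul_right (by positivity) h1

theorem odd_of_injective (hp : 0 < p) (hd : 1 < q + w) {i : ℤ} {J : ℕ}
    {f : H p q v w →* H p q v w} (hf : Function.Injective f)
    (h : f α = α ^ i * β ^ (2 ^ (p + v) * J)) : Odd i := by
  by_contra hi
  obtain ⟨i', rfl⟩ := (Int.not_odd_iff_even.1 hi).two_dvd
  obtain ⟨m, hm⟩ : ∃ m, p + q = m + 1 := ⟨p + q - 1, by omega⟩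
  have h1 : f (α ^ 2 ^ (m + q + w)) = 1 := by
    obtain ⟨z, hz⟩ := two_pow_dvd_geom_sum (q := (2 ^ (q + w) + 1) ^ (2 ^ (p + v) * J))
      ((dvd_pow_self 2 (by omega)).trans
        ((two_pow_dvd_base_pow_sub_one hd 0 _).2 (by simp))) (m + q + w)
    rw [map_pow, h, zpow_mul_pow_pow conj_α, cast_base, hz,
      show 2 ^ (p + v) * J * 2 ^ (m + q + w) = 2 ^ (p + v + q + w) * (2 ^ m * J) by ring,
      show p + v + q + w = p + q + v + w by ring, β_pow_two_pow_mul, ← zpow_add,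
      ← zpow_zero α, α_zpow_eq_iff hd, sub_zero]
    refine dvd_add ⟨i' * z, ?_⟩ ?_
    · rw [show p + 2 * q + w = m + q + w + 1 by omega]; ring
    · push_cast
      rw [← mul_assoc, ← pow_add]
      exact (pow_dvd_pow 2 (by omega)).mul_right _
  have h2 : (α : H p q v w) ^ ((2 ^ (m + q + w) : ℕ) : ℤ) = α ^ (0 : ℤ) := by
    rw [zpow_natCast, zpow_zero]
    exact hf (h1.trans (map_one f).symm)
  rw [α_zpow_eq_iff hd, sub_zero] at h2
  have h3 : 2 ^ (p + 2 * q + w) ∣ 2 ^ (m + q + w) := by exact_mod_cast h2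
  have := (Nat.pow_dvd_pow_iff_le_right (by norm_num)).1 h3
  omega

theorem even_offset (hp : 0 < p) (hv : 0 < v) (J : ℕ) (k : ℤ) : Even (offset p v J k) := by
  have h2 {n : ℕ} (hn : 0 < n) : Even ((2 : ℤ) ^ n) := by simp [Int.even_pow]; omega
  exact ((h2 hv).mul_right _).sub ((h2 hp).mul_right _)

theorem two_pow_dvd_target (hd : 1 < q + w) (J : ℕ) (k : ℤ) :
    (2 : ℤ) ^ (p + q + w) ∣ target p q v w J k := by
  refine dvd_add (Dvd.dvd.mul_left ?_ _) (dvd_mul_right _ _)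
  exact (pow_dvd_pow 2 (by omega)).trans
    ((two_pow_dvd_base_pow_sub_one hd (p + v) _).2 (dvd_mul_right _ _))

theorem twistedPow_iff (hd : 1 < q + w) (hp : 0 < p) (hq : 0 < q) (hv : 0 < v) {i k : ℤ}
    {J l : ℕ} (hi : (2 : ℤ) ^ q ∣ l + offset p v J k - i) (hl : Odd l) :
    (2 : ℤ) ^ (p + 2 * q + w) ∣
        i * ((2 ^ (q + w) + 1) ^ l - (2 ^ (q + w) + 1)) - target p q v w J k ↔
      (2 : ℤ) ^ (p + 2 * q + w) ∣
        twistedPow (q + w) (offset p v J k) l - target p q v w J k := by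
  have hlo : Odd ((l : ℤ) + offset p v J k) :=
    Odd.add_even (by exact_mod_cast hl) (even_offset hp hv J k)
  have hio : Odd i := by
    have h1 := hlo.sub_even (even_iff_two_dvd.2 ((dvd_pow_self 2 hq.ne').trans hi))
    rwa [sub_sub_cancel] at h1
  have key (h : (2 : ℤ) ^ (p + q + w) ∣ (2 ^ (q + w) + 1) ^ l - (2 ^ (q + w) + 1)) :
      (2 : ℤ) ^ (p + 2 * q + w) ∣
        (l + offset p v J k - i) * ((2 ^ (q + w) + 1) ^ l - (2 ^ (q + w) + 1)) := by
    rw [show p + 2 * q + w = q + (p + q + w) by ring, pow_add]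
    exact mul_dvd_mul hi h
  have hT := two_pow_dvd_target (p := p) (v := v) hd J k
  simp only [twistedPow]
  constructor
  · intro h
    rw [← sub_add_sub_cancel _ (i * ((2 ^ (q + w) + 1) ^ l - (2 ^ (q + w) + 1))), ← sub_mul]
    exact dvd_add (key (two_pow_dvd_of_dvd_odd_mul_sub (by omega) hio hT h)) h
  · intro h
    have h1 := dvd_sub h (key (two_pow_dvd_of_dvd_odd_mul_sub (by omega) hlo hT h))
    rwa [sub_mul, sub_sub_sub_comm, sub_self, zero_sub, neg_sub] at h1

theorem exists_root (hd : 1 < q + w) (hp : 0 < p) (hv : 0 < v) (J : ℕ) (k : ℤ) :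
    ∃ l < 2 ^ (p + q), Odd l ∧ (2 : ℤ) ^ (p + 2 * q + w) ∣
      twistedPow (q + w) (offset p v J k) l - target p q v w J k := by
  have h := exists_twistedPow_congr hd (even_offset hp hv J k) (T := target p q v w J k)
    ((pow_dvd_pow 2 (by omega)).trans (two_pow_dvd_target hd J k)) (n := p + q) (by omega)
  rwa [show q + w + (p + q) = p + 2 * q + w by ring] at h

theorem exists_eq_add_of_root (hd : 1 < q + w) {e T : ℤ} (he : Even e) {l l' : ℕ}
    (hl : Odd l) (hl' : Odd l') (hlt : l < 2 ^ (p + q)) (hlt' : l' < 2 ^ (p + q + v + w))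
    (h : (2 : ℤ) ^ (p + 2 * q + w) ∣ twistedPow (q + w) e l - T)
    (h' : (2 : ℤ) ^ (p + 2 * q + w) ∣ twistedPow (q + w) e l' - T) :
    ∃ u < 2 ^ (w + v), l' = l + 2 ^ (p + q) * u := by
  rw [show p + 2 * q + w = q + w + (p + q) by ring] at h h'
  rcases le_total l l' with hle | hle
  · obtain ⟨D, rfl⟩ := Nat.exists_eq_add_of_le hle
    obtain ⟨u, rfl⟩ := two_pow_dvd_of_twistedPow hd he hl hl'
      (by simpa using dvd_sub h' h)
    refine ⟨u, ?_, rfl⟩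
    rw [show p + q + v + w = p + q + (w + v) by ring, pow_add 2 (p + q)] at hlt'
    exact Nat.lt_of_mul_lt_mul_left (lt_of_le_of_lt (Nat.le_add_left _ _) hlt')
  · obtain ⟨D, rfl⟩ := Nat.exists_eq_add_of_le hle
    have hD := two_pow_dvd_of_twistedPow hd he hl' hl (by simpa using dvd_sub h h')
    have : D = 0 := Nat.eq_zero_of_dvd_of_lt hD (by omega)
    exact ⟨0, by positivity, by simp [this]⟩

theorem surjective_of_odd (hd : 1 < q + w) {i k : ℤ} {j l : ℕ} (hi : Odd i) (hj : Even j)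
    (hl : Odd l) {f : H p q v w →* H p q v w} (hα : f α = α ^ i * β ^ j)
    (hβ : f β = α ^ k * β ^ l) : Function.Surjective f := by
  have h4 : (4 : ℤ) ∣ (2 ^ (q + w) + 1 : ℕ) - 1 := by
    rw [cast_base, add_sub_cancel_right]
    exact pow_dvd_pow (2 : ℤ) hd
  have hN : (α : H p q v w) ^ 2 ^ (p + 2 * q + w + (p + q + v + w)) = 1 := by
    rw [pow_add 2 (p + 2 * q + w) (p + q + v + w), pow_mul α, α_pow, one_pow]
  have hN' : (β : H p q v w) ^ 2 ^ (p + 2 * q + w + (p + q + v + w)) = 1 := by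
    rw [pow_add 2 (p + 2 * q + w) (p + q + v + w), mul_comm (2 ^ _), pow_mul β, β_pow,
      pow_right_comm, α_pow, one_pow]
  obtain ⟨h1, h2⟩ := mem_of_zpow_mul_pow_mem (conj_α (n := 2 ^ (p + 2 * q + w))
    (m := 2 ^ (p + q + v + w)) (t := 2 ^ (p + q + w))) h4 (K := f.range) (hN ▸ one_mem _)
    (hN' ▸ one_mem _) hi hj hl ⟨α, hα⟩ ⟨β, hβ⟩
  intro g
  obtain ⟨x, y, rfl⟩ := exists_eq_zpow_mul_pow (by positivity) (by positivity) g
  exact mul_mem (zpow_mem h1 x) (pow_mem h2 y)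

theorem exists_mulAut (hd : 1 < q + w) (hp : 0 < p) (hq : 0 < q) (hv : 0 < v) {i k : ℤ}
    {J l : ℕ} (hl : Odd l) (hi : (2 : ℤ) ^ q ∣ l + offset p v J k - i)
    (h : (2 : ℤ) ^ (p + 2 * q + w) ∣
      twistedPow (q + w) (offset p v J k) l - target p q v w J k) :
    ∃ φ : MulAut (H p q v w), φ α = α ^ i * β ^ (2 ^ (p + v) * J) ∧ φ β = α ^ k * β ^ l := by
  have hio : Odd i := by
    have hlo : Odd ((l : ℤ) + offset p v J k) :=
      Odd.add_even (by exact_mod_cast hl) (even_offset hp hv J k)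
    have h1 := hlo.sub_even (even_iff_two_dvd.2 ((dvd_pow_self 2 hq.ne').trans hi))
    rwa [sub_sub_cancel] at h1
  let f : H p q v w →* H p q v w := lift (pow_eq_one hd i J) ((pow_eq_pow_iff hd hv).2 hi)
    ((conj_eq_pow_iff hd hv).2 ((twistedPow_iff hd hp hq hv hi hl).2 h))
  have hsurj : Function.Surjective f :=
    surjective_of_odd hd hio (Even.mul_right (by simp [Nat.even_pow]; omega) J) hl
      (lift_α _ _ _) (lift_β _ _ _)
  have : Finite (H p q v w) := finite (by positivity) (by positivity)
  have hfα : f α = α ^ i * β ^ (2 ^ (p + v) * J) := lift_α _ _ _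
  have hfβ : f β = α ^ k * β ^ l := lift_β _ _ _
  exact ⟨MulEquiv.ofBijective f ⟨Finite.injective_iff_surjective.2 hsurj, hsurj⟩, hfα, hfβ⟩

theorem exists_of_mulAut (hd : 1 < q + w) (hp : 0 < p) (hq : 0 < q) (hv : 0 < v)
    (φ : MulAut (H p q v w)) :
    ∃ (i : ℤ) (J k l : ℕ), J < 2 ^ (q + w) ∧ k < 2 ^ (p + 2 * q + w) ∧
      l < 2 ^ (p + q + v + w) ∧ Odd l ∧ (2 : ℤ) ^ q ∣ l + offset p v J k - i ∧
      (2 : ℤ) ^ (p + 2 * q + w) ∣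
        twistedPow (q + w) (offset p v J k) l - target p q v w J k ∧
      φ α = α ^ i * β ^ (2 ^ (p + v) * J) ∧ φ β = α ^ (k : ℤ) * β ^ l := by
  obtain ⟨i, -, j, hj, hx⟩ := exists_eq_zpow_mul_pow_lt (by positivity) (by positivity) (φ α)
  obtain ⟨k, hk, l, hl, hy⟩ := exists_eq_zpow_mul_pow_lt (by positivity) (by positivity) (φ β)
  have hconj : φ β * φ α * (φ β)⁻¹ = φ α ^ (2 ^ (q + w) + 1) := by
    rw [← map_inv, ← map_mul, ← map_mul, ← map_pow, conj_α]
  have hpow : φ β ^ 2 ^ (p + q + v + w) = φ α ^ 2 ^ (p + q + w) := by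
    rw [← map_pow, ← map_pow, β_pow]
  rw [hx, hy] at hconj hpow
  obtain ⟨J, rfl⟩ := exists_eq_of_conj_eq_pow hd hconj
  have hi : Odd (i : ℤ) := odd_of_injective hp hd (f := φ.toMonoidHom) φ.injective hx
  rw [pow_eq_pow_iff hd hv] at hpow
  rw [conj_eq_pow_iff hd hv] at hconj
  have hlo : Odd l := by
    have h1 := (even_iff_two_dvd.2 ((dvd_pow_self 2 hq.ne').trans hpow)).add_odd hi
    rw [sub_add_cancel] at h1
    have h2 := h1.sub_even (even_offset hp hv J k)
    rw [add_sub_cancel_right] at h2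
    exact_mod_cast h2
  refine ⟨i, J, k, l, ?_, hk, hl, hlo, hpow, (twistedPow_iff hd hp hq hv hpow hlo).1 hconj,
    hx, hy⟩
  rw [show p + q + v + w = p + v + (q + w) by ring, pow_add 2 (p + v)] at hj
  exact Nat.lt_of_mul_lt_mul_left hj

theorem card_mulAut (hd : 1 < q + w) (hp : 0 < p) (hq : 0 < q) (hv : 0 < v) :
    Nat.card (MulAut (H p q v w)) =
      2 ^ (q + w) * (2 ^ (p + 2 * q + w) * (2 ^ (w + v) * 2 ^ (p + q + w))) := by
  choose L hLlt hLodd hL using fun J (k : ℕ) => exists_root (q := q) (w := w) hd hp hv J (k : ℤ)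
  let L' (J k u : ℕ) : ℕ := L J k + 2 ^ (p + q) * u
  let I (J k u s : ℕ) : ℤ := L' J k u + offset p v J k + 2 ^ q * s
  let P := Fin (2 ^ (q + w)) × Fin (2 ^ (p + 2 * q + w)) × Fin (2 ^ (w + v)) ×
    Fin (2 ^ (p + q + w))
  let g : P → H p q v w × H p q v w := fun x =>
    (α ^ I x.1 x.2.1 x.2.2.1 x.2.2.2 * β ^ (2 ^ (p + v) * (x.1 : ℕ)),
      α ^ ((x.2.1 : ℕ) : ℤ) * β ^ L' x.1 x.2.1 x.2.2.1)
  let f : MulAut (H p q v w) → H p q v w × H p q v w := fun φ => (φ α, φ β)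
  have hf : Function.Injective f := fun φ ψ h => by
    have h1 : φ.toMonoidHom = ψ.toMonoidHom :=
      hom_ext (congrArg Prod.fst h) (congrArg Prod.snd h)
    exact MulEquiv.toMonoidHom_injective h1
  have hL'lt {J k u : ℕ} (hu : u < 2 ^ (w + v)) : L' J k u < 2 ^ (p + q + v + w) := by
    have h1 := hLlt J k
    calc L' J k u < 2 ^ (p + q) * (u + 1) := by simp only [L']; linarith
      _ ≤ 2 ^ (p + q) * 2 ^ (w + v) := Nat.mul_le_mul_left _ hu
      _ = 2 ^ (p + q + v + w) := by ring
  have hJlt {J : ℕ} (hJ : J < 2 ^ (q + w)) : 2 ^ (p + v) * J < 2 ^ (p + q + v + w) := by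
    calc 2 ^ (p + v) * J < 2 ^ (p + v) * 2 ^ (q + w) := by gcongr
      _ = 2 ^ (p + q + v + w) := by ring
  have eq_of_dvd {n x y : ℕ} (hx : x < n) (hy : y < n) (h : (n : ℤ) ∣ x - y) : x = y :=
    ((Nat.modEq_iff_dvd.2 h).eq_of_lt_of_lt hy hx).symm
  have hg : Function.Injective g := by
    rintro ⟨⟨J, hJ⟩, ⟨k, hk⟩, ⟨u, hu⟩, ⟨s, hs⟩⟩ ⟨⟨J', hJ'⟩, ⟨k', hk'⟩, ⟨u', hu'⟩, ⟨s', hs'⟩⟩ h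
    obtain ⟨h1, h2⟩ := Prod.mk.inj h
    obtain ⟨h3, h4⟩ := eq_of_zpow_mul_pow_eq hd (hJlt hJ) (hJlt hJ') h1
    obtain ⟨h5, h6⟩ := eq_of_zpow_mul_pow_eq hd (hL'lt hu) (hL'lt hu') h2
    obtain rfl : J = J' := Nat.eq_of_mul_eq_mul_left (by positivity) h3
    obtain rfl : k = k' := eq_of_dvd hk hk' (by exact_mod_cast h6)
    obtain rfl : u = u' := Nat.eq_of_mul_eq_mul_left (by positivity) (Nat.add_left_cancel h5)
    have h7 : (2 : ℤ) ^ q * 2 ^ (p + q + w) ∣ 2 ^ q * (s - s') := by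
      convert h4 using 1 <;> ring
    obtain rfl : s = s' := eq_of_dvd hs hs' (by
      exact_mod_cast (mul_dvd_mul_iff_left (by positivity)).1 h7)
    rfl
  have hL' (J k u : ℕ) : Odd (L' J k u) ∧ (2 : ℤ) ^ (p + 2 * q + w) ∣
      twistedPow (q + w) (offset p v J k) (L' J k u) - target p q v w J k := by
    refine ⟨(hLodd J k).add_even (Even.mul_right (by simp [Nat.even_pow]; omega) u), ?_⟩
    have h1 := twistedPow_congr hd (e := offset p v J k) (hLodd J k)
      (Nat.dvd_mul_right (2 ^ (p + q)) u)
    rw [show q + w + (p + q) = p + 2 * q + w by ring] at h1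
    simpa [L'] using dvd_add h1 (hL J k)
  have hrange : Set.range f = Set.range g := by
    ext z
    constructor
    · rintro ⟨φ, rfl⟩
      obtain ⟨i, J, k, l, hJ, hk, hl, hlo, hi, htw, hx, hy⟩ := exists_of_mulAut hd hp hq hv φ
      obtain ⟨u, hu, rfl⟩ := exists_eq_add_of_root hd (even_offset hp hv J k) (hLodd J k) hlo
        (hLlt J k) hl (hL J k) htw
      obtain ⟨y, hy'⟩ := hi
      have hpos : (0 : ℤ) < 2 ^ (p + q + w) := by positivity
      have hs : ((-y % 2 ^ (p + q + w)).toNat : ℤ) = -y % 2 ^ (p + q + w) :=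
        Int.toNat_of_nonneg (Int.emod_nonneg _ hpos.ne')
      refine ⟨(⟨J, hJ⟩, ⟨k, hk⟩, ⟨u, hu⟩, ⟨(-y % 2 ^ (p + q + w)).toNat, ?_⟩), ?_⟩
      · zify
        rw [hs]
        exact Int.emod_lt_of_pos _ hpos
      · refine Prod.ext ?_ hy.symm
        refine Eq.trans ?_ hx.symm
        simp only [g]
        congr 1
        rw [α_zpow_eq_iff hd]
        simp only [I, L', hs]
        obtain ⟨x, hx'⟩ := Int.dvd_self_sub_emod (x := -y) (m := 2 ^ (p + q + w))
        refine ⟨-x, ?_⟩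
        linear_combination hy' - 2 ^ q * hx'
    · rintro ⟨⟨J, k, u, s⟩, rfl⟩
      obtain ⟨φ, h1, h2⟩ := exists_mulAut hd hp hq hv (hL' J k u).1 (i := I J k u s)
        ⟨-s, by simp only [I]; ring⟩ (hL' J k u).2
      exact ⟨φ, Prod.ext h1 h2⟩
  rw [Nat.card_congr (Equiv.ofInjective f hf), hrange, ← Nat.card_congr (Equiv.ofInjective g hg)]
  simp only [P, Nat.card_prod, Nat.card_fin]

end TypeI

/-- Theorem 3.1 (order part): for `H = H(2^a, 2^b; 2^c, 2^d + 1)` with `d > 1` and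
`max{d, a-d-1} < c < min{a, b}`, the automorphism group of `H` has order `2^(b+c+2d)`. -/
theorem typeI_aut_card (a b c d : ℕ) (hd : 1 < d) (hdc : d < c) (hac : a - d - 1 < c)
    (hca : c < a) (hcb : c < b) :
    Nat.card (MulAut (Metacyclic (2 ^ a) (2 ^ b) (2 ^ c) (2 ^ d + 1)))
      = 2 ^ (b + c + 2 * d) := by
  obtain ⟨p, rfl⟩ := Nat.exists_eq_add_of_lt hdc
  obtain ⟨q, rfl⟩ := Nat.exists_eq_add_of_lt hca
  obtain ⟨v, rfl⟩ := Nat.exists_eq_add_of_lt hcb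
  obtain ⟨w, rfl⟩ : ∃ w, d = q + 1 + w := ⟨d - (q + 1), by omega⟩
  rw [show q + 1 + w + p + 1 + q + 1 = p + 1 + 2 * (q + 1) + w by ring,
    show q + 1 + w + p + 1 + v + 1 = p + 1 + (q + 1) + (v + 1) + w by ring,
    show q + 1 + w + p + 1 = p + 1 + (q + 1) + w by ring]
  refine (TypeI.card_mulAut (p := p + 1) (v := v + 1) hd p.succ_pos q.succ_pos v.succ_pos).trans ?_
  ring
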